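/- Let ρ_AB be a density operator on H_A ⊗ H_B. Let α > 0 and β, γ ≥ 1/2 with α, β, γ ≠ 1 satisfy α/(α−1) = β/(β−1) + γ/(γ−1) and (α−1)(β−1)(γ−1) < 0. Then I↓_γ(A:B)_ρ ≤ H_β(B)_ρ − H↑_α(B|A)_ρ. -/

import Mathlib

open scoped Kronecker ComplexOrder Classical
open Matrix

noncomputable section

/-- Real power taken on the support: `0 ^ r = 0` for every `r`. -/
def supPow (x r : ℝ) : ℝ := if x = 0 then 0 else x ^ r

variable {n : Type*} [Fintype n] [DecidableEq n]

/-- Power of a Hermitian matrix, taken on its support (junk value `0` otherwise). -/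
def matPow (M : Matrix n n ℂ) (r : ℝ) : Matrix n n ℂ :=
  if hM : M.IsHermitian then
    (hM.eigenvectorUnitary : Matrix n n ℂ) *
      (Matrix.diagonal fun i => (supPow (hM.eigenvalues i) r : ℂ)) *
      (star (hM.eigenvectorUnitary : Matrix n n ℂ))
  else 0

/-- A density operator: positive semidefinite with unit trace. -/
def IsDensity (ρ : Matrix n n ℂ) : Prop := ρ.PosSemidef ∧ ρ.trace = 1

/-- `σ` dominates `ρ`: the kernel of `σ` is contained in the kernel of `ρ`
(equivalently, `supp ρ ⊆ supp σ` for positive semidefinite matrices). -/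
def Dominates (σ ρ : Matrix n n ℂ) : Prop := ∀ v, σ.mulVec v = 0 → ρ.mulVec v = 0

/-- The sandwiched Rényi divergence of order `α` (base-2 logarithm), with value `⊤`
when `ρ ⟂ σ`, or when `α > 1` and `supp ρ ⊄ supp σ`. -/
def renyiDiv (α : ℝ) (ρ σ : Matrix n n ℂ) : EReal :=
  if (ρ * σ).trace ≠ 0 ∧ (Dominates σ ρ ∨ α < 1) then
    (((α - 1)⁻¹ * Real.logb 2
      ((matPow (matPow σ ((1 - α) / (2 * α)) * ρ * matPow σ ((1 - α) / (2 * α))) α).trace.re) : ℝ)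
      : EReal)
  else ⊤

/-- The Rényi entropy of order `α` (base-2 logarithm). -/
def renyiEntropy (α : ℝ) (ρ : Matrix n n ℂ) : ℝ :=
  (1 - α)⁻¹ * Real.logb 2 ((matPow ρ α).trace.re)

variable {A B : Type*} [Fintype A] [Fintype B] [DecidableEq A] [DecidableEq B]

/-- Marginal on the first factor: `ρ_A = tr_B ρ_AB`. -/
def margFst (ρ : Matrix (A × B) (A × B) ℂ) : Matrix A A ℂ :=
  Matrix.of fun a a' => ∑ b, ρ (a, b) (a', b)

/-- Marginal on the second factor: `ρ_B = tr_A ρ_AB`. -/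
def margSnd (ρ : Matrix (A × B) (A × B) ℂ) : Matrix B B ℂ :=
  Matrix.of fun b b' => ∑ a, ρ (a, b) (a, b')

/-- `H↓_α(B|A)_ρ = −D_α(ρ_AB ‖ ρ_A ⊗ 1_B)`. -/
def condEntDown (α : ℝ) (ρ : Matrix (A × B) (A × B) ℂ) : EReal :=
  - renyiDiv α ρ (margFst ρ ⊗ₖ (1 : Matrix B B ℂ))

/-- `H↑_α(B|A)_ρ = sup_{σ_A} −D_α(ρ_AB ‖ σ_A ⊗ 1_B)`. -/
def condEntUp (α : ℝ) (ρ : Matrix (A × B) (A × B) ℂ) : EReal :=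
  ⨆ σA : {σ : Matrix A A ℂ // IsDensity σ},
    - renyiDiv α ρ ((σA : Matrix A A ℂ) ⊗ₖ (1 : Matrix B B ℂ))

/-- `I↑_γ(A;B)_ρ = inf_{σ_B} D_γ(ρ_AB ‖ ρ_A ⊗ σ_B)`. -/
def mutInfUp (γ : ℝ) (ρ : Matrix (A × B) (A × B) ℂ) : EReal :=
  ⨅ σB : {σ : Matrix B B ℂ // IsDensity σ},
    renyiDiv γ ρ (margFst ρ ⊗ₖ (σB : Matrix B B ℂ))

/-- `I↓_γ(A:B)_ρ = inf_{σ_A, σ_B} D_γ(ρ_AB ‖ σ_A ⊗ σ_B)`. -/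
def mutInfDown (γ : ℝ) (ρ : Matrix (A × B) (A × B) ℂ) : EReal :=
  ⨅ σA : {σ : Matrix A A ℂ // IsDensity σ}, ⨅ σB : {σ : Matrix B B ℂ // IsDensity σ},
    renyiDiv γ ρ ((σA : Matrix A A ℂ) ⊗ₖ (σB : Matrix B B ℂ))

end

section MatrixPower

variable {n : Type*} [Fintype n] [DecidableEq n]

theorem unitary_conj_diagonal_comp {U V : Matrix n n ℂ} (hU : U ∈ Matrix.unitaryGroup n ℂ)
    (hV : V ∈ Matrix.unitaryGroup n ℂ) {d e : n → ℝ}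
    (h : V * diagonal (fun i => (e i : ℂ)) * star V = U * diagonal (fun i => (d i : ℂ)) * star U)
    (f : ℝ → ℝ) :
    V * diagonal (fun i => (f (e i) : ℂ)) * star V =
      U * diagonal (fun i => (f (d i) : ℂ)) * star U := by
  have hV1 : star V * V = 1 := (Matrix.mem_unitaryGroup_iff').1 hV
  have hV2 : V * star V = 1 := (Matrix.mem_unitaryGroup_iff).1 hV
  have hU1 : star U * U = 1 := (Matrix.mem_unitaryGroup_iff').1 hU
  have hU2 : U * star U = 1 := (Matrix.mem_unitaryGroup_iff).1 hU
  have hcomm : (star U * V) * diagonal (fun i => (e i : ℂ)) =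
      diagonal (fun i => (d i : ℂ)) * (star U * V) := by
    calc (star U * V) * diagonal (fun i => (e i : ℂ))
        = star U * (V * diagonal (fun i => (e i : ℂ)) * star V) * V := by
          simp only [Matrix.mul_assoc, hV1, Matrix.mul_one]
      _ = _ := by rw [h]; simp only [← Matrix.mul_assoc, hU1, Matrix.one_mul]
  have hcomm' : (star U * V) * diagonal (fun i => (f (e i) : ℂ)) =
      diagonal (fun i => (f (d i) : ℂ)) * (star U * V) := by
    ext i j
    have h := congrFun (congrFun hcomm i) j
    rw [mul_diagonal, diagonal_mul] at h ⊢
    rcases eq_or_ne ((star U * V) i j) 0 with h0 | h0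
    · simp [h0]
    · rw [mul_comm] at h
      rw [Complex.ofReal_injective (mul_right_cancel₀ h0 h), mul_comm]
  calc V * diagonal (fun i => (f (e i) : ℂ)) * star V
      = U * ((star U * V) * diagonal (fun i => (f (e i) : ℂ))) * star V := by
        simp only [← Matrix.mul_assoc, hU2, Matrix.one_mul]
    _ = _ := by
        rw [hcomm']
        simp only [Matrix.mul_assoc, hV2, Matrix.mul_one]

theorem isHermitian_unitary_conj_diagonal (U : Matrix n n ℂ) (d : n → ℝ) :
    (U * diagonal (fun i => (d i : ℂ)) * star U).IsHermitian := by
  refine isHermitian_mul_mul_conjTranspose U (isHermitian_diagonal_of_self_adjoint _ ?_)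
  ext i
  simp

theorem Matrix.IsHermitian.eq_unitary_conj_diagonal {M : Matrix n n ℂ} (hM : M.IsHermitian) :
    M = (hM.eigenvectorUnitary : Matrix n n ℂ) * diagonal (fun i => (hM.eigenvalues i : ℂ)) *
      star (hM.eigenvectorUnitary : Matrix n n ℂ) := by
  have h := hM.spectral_theorem
  rwa [Unitary.conjStarAlgAut_apply] at h

theorem Matrix.IsHermitian.exists_unitary_diagonal {M : Matrix n n ℂ} (hM : M.IsHermitian) :
    ∃ U ∈ Matrix.unitaryGroup n ℂ,
      M = U * diagonal (fun i => (hM.eigenvalues i : ℂ)) * star U :=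
  ⟨hM.eigenvectorUnitary, hM.eigenvectorUnitary.2, hM.eq_unitary_conj_diagonal⟩

theorem matPow_unitary_conj (U : Matrix n n ℂ) (hU : U ∈ Matrix.unitaryGroup n ℂ) (d : n → ℝ)
    (r : ℝ) :
    matPow (U * diagonal (fun i => (d i : ℂ)) * star U) r =
      U * diagonal (fun i => (supPow (d i) r : ℂ)) * star U := by
  have hM := isHermitian_unitary_conj_diagonal U d
  rw [matPow, dif_pos hM]
  exact unitary_conj_diagonal_comp hU hM.eigenvectorUnitary.2 hM.eq_unitary_conj_diagonal.symm
    fun x => supPow x r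

theorem trace_unitary_conj (U : Matrix n n ℂ) (hU : U ∈ Matrix.unitaryGroup n ℂ)
    (M : Matrix n n ℂ) : (U * M * star U).trace = M.trace := by
  rw [Matrix.trace_mul_cycle, (Matrix.mem_unitaryGroup_iff').1 hU, Matrix.one_mul]

theorem trace_matPow_unitary_conj (U : Matrix n n ℂ) (hU : U ∈ Matrix.unitaryGroup n ℂ)
    {M : Matrix n n ℂ} (hM : M.IsHermitian) (r : ℝ) :
    (matPow (U * M * star U) r).trace = (matPow M r).trace := by
  obtain ⟨V, hV, hMV⟩ := hM.exists_unitary_diagonal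
  have hUV : U * V ∈ Matrix.unitaryGroup n ℂ := mul_mem hU hV
  have h : U * M * star U = (U * V) * diagonal (fun i => (hM.eigenvalues i : ℂ)) * star (U * V) := by
    conv_lhs => rw [hMV]
    simp only [star_mul, Matrix.mul_assoc]
  rw [h, matPow_unitary_conj _ hUV, trace_unitary_conj _ hUV]
  conv_rhs => rw [hMV, matPow_unitary_conj _ hV, trace_unitary_conj _ hV]

end MatrixPower

section Schatten

open scoped Matrix.Norms.L2Operator

variable {n : Type*} [Fintype n] [DecidableEq n]

theorem sum_norm_sq_col_le {P : Matrix n n ℂ} (hP : ‖P‖ ≤ 1) (j : n) :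
    ∑ i, ‖P i j‖ ^ 2 ≤ 1 := by
  have h := P.l2_opNorm_mulVec (EuclideanSpace.single j (1 : ℂ))
  have h1 : ‖(EuclideanSpace.single j (1 : ℂ))‖ = 1 := by simp
  rw [h1, mul_one] at h
  have h2 := h.trans hP
  rw [EuclideanSpace.norm_eq, Real.sqrt_le_one] at h2
  simpa using h2

theorem sum_norm_sq_row_le {P : Matrix n n ℂ} (hP : ‖P‖ ≤ 1) (i : n) :
    ∑ j, ‖P i j‖ ^ 2 ≤ 1 := by
  have h := sum_norm_sq_col_le (P := Pᴴ) (by rwa [l2_opNorm_conjTranspose]) i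
  simpa using h

theorem norm_le_one_of_mem_unitaryGroup {U : Matrix n n ℂ} (hU : U ∈ Matrix.unitaryGroup n ℂ) :
    ‖U‖ ≤ 1 := by
  have h := l2_opNorm_conjTranspose_mul_self U
  rw [← star_eq_conjTranspose, (Matrix.mem_unitaryGroup_iff').1 hU] at h
  have h1 : ‖(1 : Matrix n n ℂ)‖ ≤ 1 := by
    rw [← diagonal_one, l2_opNorm_diagonal, pi_norm_le_iff_of_nonneg zero_le_one]
    simp
  nlinarith [norm_nonneg U]

theorem exists_singular_value_decomposition (M : Matrix n n ℂ) :
    ∃ (U V : Matrix n n ℂ) (s : n → ℝ), (∀ i, 0 ≤ s i) ∧ ‖U‖ ≤ 1 ∧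
      V ∈ Matrix.unitaryGroup n ℂ ∧ M = U * diagonal (fun i => (s i : ℂ)) * star V ∧
      Uᴴ * U = diagonal (fun i => if s i = 0 then (0 : ℂ) else 1) ∧
      Mᴴ * M = V * diagonal (fun i => ((s i ^ 2 : ℝ) : ℂ)) * star V := by
  have hpos := posSemidef_conjTranspose_mul_self M
  have hM := hpos.isHermitian
  obtain ⟨V, hV, hMV⟩ := hM.exists_unitary_diagonal
  set l := hM.eigenvalues with hl
  have hl0 : ∀ i, 0 ≤ l i := hpos.eigenvalues_nonneg
  have hV1 : star V * V = 1 := (Matrix.mem_unitaryGroup_iff').1 hV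
  have hV2 : V * star V = 1 := (Matrix.mem_unitaryGroup_iff).1 hV
  have hG : (M * V)ᴴ * (M * V) = diagonal (fun i => (l i : ℂ)) := by
    rw [conjTranspose_mul, Matrix.mul_assoc, ← Matrix.mul_assoc Mᴴ, hMV,
      ← star_eq_conjTranspose]
    simp only [← Matrix.mul_assoc, hV1, Matrix.one_mul]
    rw [Matrix.mul_assoc, hV1, Matrix.mul_one]
  have hU : (M * V * diagonal (fun i => (((Real.sqrt (l i))⁻¹ : ℝ) : ℂ)))ᴴ *
      (M * V * diagonal (fun i => (((Real.sqrt (l i))⁻¹ : ℝ) : ℂ))) =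
      diagonal (fun i => if Real.sqrt (l i) = 0 then (0 : ℂ) else 1) := by
    rw [conjTranspose_mul, Matrix.mul_assoc, ← Matrix.mul_assoc (M * V)ᴴ, hG,
      diagonal_conjTranspose, diagonal_mul_diagonal, diagonal_mul_diagonal]
    congr 1
    ext i
    by_cases h : Real.sqrt (l i) = 0
    · simp [h]
    · have h2 : (l i : ℂ) = ((Real.sqrt (l i) : ℝ) : ℂ) * (Real.sqrt (l i) : ℝ) := by
        rw [← Complex.ofReal_mul, Real.mul_self_sqrt (hl0 i)]
      have h3 : ((Real.sqrt (l i) : ℝ) : ℂ) ≠ 0 := by exact_mod_cast h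
      simp only [Pi.star_apply, if_neg h]
      rw [RCLike.star_def, Complex.conj_ofReal]
      conv_lhs => rw [h2]
      push_cast
      field_simp
  refine ⟨M * V * diagonal (fun i => (((Real.sqrt (l i))⁻¹ : ℝ) : ℂ)), V,
    fun i => Real.sqrt (l i), fun i => Real.sqrt_nonneg _, ?_, hV, ?_, hU, ?_⟩
  · have h := l2_opNorm_conjTranspose_mul_self
      (M * V * diagonal (fun i => (((Real.sqrt (l i))⁻¹ : ℝ) : ℂ)))
    rw [hU, l2_opNorm_diagonal] at h
    have h1 : ‖fun i => if Real.sqrt (l i) = 0 then (0 : ℂ) else 1‖ ≤ 1 := by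
      rw [pi_norm_le_iff_of_nonneg zero_le_one]
      intro i
      split_ifs <;> simp
    nlinarith [norm_nonneg (M * V * diagonal (fun i => (((Real.sqrt (l i))⁻¹ : ℝ) : ℂ)))]
  · have hcol : M * V * diagonal (fun i => (((Real.sqrt (l i))⁻¹ : ℝ) : ℂ)) *
        diagonal (fun i => ((Real.sqrt (l i) : ℝ) : ℂ)) = M * V := by
      rw [Matrix.mul_assoc, diagonal_mul_diagonal]
      ext i j
      rw [mul_diagonal]
      by_cases h : Real.sqrt (l j) = 0
      · have hj := congrFun (congrFun hG j) j
        have hlj : l j = 0 := (Real.sqrt_eq_zero (hl0 j)).1 h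
        rw [diagonal_apply_eq, hlj, Matrix.mul_apply] at hj
        have hj' : ∑ k, ‖(M * V) k j‖ ^ 2 = 0 := by
          have : ∑ k, (M * V)ᴴ j k * (M * V) k j = ((∑ k, ‖(M * V) k j‖ ^ 2 : ℝ) : ℂ) := by
            push_cast
            refine Finset.sum_congr rfl fun k _ => ?_
            rw [conjTranspose_apply, RCLike.star_def, Complex.conj_mul']
          rw [this] at hj
          exact_mod_cast hj
        have := (Finset.sum_eq_zero_iff_of_nonneg (fun k _ => by positivity)).1 hj' i
          (Finset.mem_univ i)
        have hz : (M * V) i j = 0 := by simpa using this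
        rw [hz, zero_mul]
      · rw [← Complex.ofReal_mul, inv_mul_cancel₀ h]
        simp
    rw [hcol, Matrix.mul_assoc, hV2, Matrix.mul_one]
  · conv_lhs => rw [hMV]
    simp only [Real.sq_sqrt (hl0 _)]

/-- The `p`-th power of the Schatten `p`-norm. -/
noncomputable def schattenSum (p : ℝ) (M : Matrix n n ℂ) : ℝ := (matPow (Mᴴ * M) (p / 2)).trace.re

theorem supPow_sq {x p : ℝ} (hx : 0 ≤ x) (hp : p ≠ 0) : supPow (x ^ 2) (p / 2) = x ^ p := by
  rw [supPow]
  split_ifs with h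
  · rw [pow_eq_zero_iff two_ne_zero] at h
    rw [h, Real.zero_rpow hp]
  · rw [← Real.rpow_natCast, ← Real.rpow_mul hx]
    congr 1
    push_cast
    ring

theorem schattenSum_eq_sum {p : ℝ} (hp : p ≠ 0) {M V : Matrix n n ℂ} {s : n → ℝ}
    (hs : ∀ i, 0 ≤ s i) (hV : V ∈ Matrix.unitaryGroup n ℂ)
    (hM : Mᴴ * M = V * diagonal (fun i => ((s i ^ 2 : ℝ) : ℂ)) * star V) :
    schattenSum p M = ∑ i, s i ^ p := by
  rw [schattenSum, hM, matPow_unitary_conj _ hV, trace_unitary_conj _ hV, trace_diagonal,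
    Complex.re_sum]
  refine Finset.sum_congr rfl fun i _ => ?_
  rw [Complex.ofReal_re, supPow_sq (hs i) hp]

theorem schattenSum_nonneg {p : ℝ} (hp : p ≠ 0) (M : Matrix n n ℂ) : 0 ≤ schattenSum p M := by
  obtain ⟨U, V, s, hs, -, hV, -, -, hM⟩ := exists_singular_value_decomposition M
  rw [schattenSum_eq_sum hp hs hV hM]
  exact Finset.sum_nonneg fun i _ => Real.rpow_nonneg (hs i) _

theorem schattenSum_pos {p : ℝ} (hp : p ≠ 0) {M : Matrix n n ℂ} (hM0 : M ≠ 0) :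
    0 < schattenSum p M := by
  obtain ⟨U, V, s, hs, -, hV, hMU, -, hM⟩ := exists_singular_value_decomposition M
  rw [schattenSum_eq_sum hp hs hV hM]
  have hex : ∃ i, s i ≠ 0 := by
    by_contra! h
    exact hM0 (by rw [hMU]; simp [h])
  obtain ⟨i, hi⟩ := hex
  exact Finset.sum_pos' (fun i _ => Real.rpow_nonneg (hs i) _)
    ⟨i, Finset.mem_univ i, Real.rpow_pos_of_pos ((hs i).lt_of_ne' hi) _⟩

theorem schattenSum_two (M : Matrix n n ℂ) : schattenSum 2 M = ∑ j, ∑ i, ‖M i j‖ ^ 2 := by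
  obtain ⟨U, V, s, hs, -, hV, -, -, hM⟩ := exists_singular_value_decomposition M
  have h1 : (Mᴴ * M).trace = ((∑ j, ∑ i, ‖M i j‖ ^ 2 : ℝ) : ℂ) := by
    rw [Matrix.trace]
    push_cast
    refine Finset.sum_congr rfl fun j _ => ?_
    rw [diag_apply, Matrix.mul_apply]
    refine Finset.sum_congr rfl fun i _ => ?_
    rw [conjTranspose_apply, RCLike.star_def, Complex.conj_mul']
  have h2 : (Mᴴ * M).trace = ((∑ i, s i ^ 2 : ℝ) : ℂ) := by
    rw [hM, trace_unitary_conj _ hV, trace_diagonal]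
    push_cast
    rfl
  rw [schattenSum_eq_sum two_ne_zero hs hV hM]
  rw [h1] at h2
  have := Complex.ofReal_injective h2
  rw [this]
  simp

/-- Trace form of Hölder's inequality for Schatten norms. -/
theorem norm_trace_mul_le_schatten {p : ℝ} (hp : 1 ≤ p) (M Y Z : Matrix n n ℂ) (hY : ‖Y‖ ≤ 1)
    (hZ : ‖Z‖ ≤ 1) (r : n → ℝ) (hr : ∀ j, 0 ≤ r j) :
    ‖(M * Y * diagonal (fun j => (supPow (r j) (1 - p⁻¹) : ℂ)) * Z).trace‖ ≤
      schattenSum p M ^ p⁻¹ * (∑ j, r j) ^ (1 - p⁻¹) := by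
  have hp0 : 0 < p := by linarith
  obtain ⟨U, V, s, hs, hU, hV, hMU, -, hM⟩ := exists_singular_value_decomposition M
  rw [schattenSum_eq_sum hp0.ne' hs hV hM]
  set P := star V * Y with hPdef
  set R := Z * U with hRdef
  set t : n → ℝ := fun j => supPow (r j) (1 - p⁻¹) with ht
  have ht0 : ∀ j, 0 ≤ t j := fun j => by
    simp only [ht, supPow]
    split_ifs
    · exact le_rfl
    · exact Real.rpow_nonneg (hr j) _
  have hP : ‖P‖ ≤ 1 := by
    have h1 : ‖star V‖ ≤ 1 := norm_le_one_of_mem_unitaryGroup (Unitary.star_mem hV)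
    exact (l2_opNorm_mul _ _).trans (mul_le_one₀ h1 (norm_nonneg _) hY)
  have hR : ‖R‖ ≤ 1 := (l2_opNorm_mul _ _).trans (mul_le_one₀ hZ (norm_nonneg _) hU)
  set D : n → n → ℝ := fun i j => (‖P i j‖ ^ 2 + ‖R j i‖ ^ 2) / 2 with hD
  have hD0 : ∀ i j, 0 ≤ D i j := fun i j => by simp only [hD]; positivity
  have hDrow : ∀ i, ∑ j, D i j ≤ 1 := fun i => by
    simp only [hD]
    rw [← Finset.sum_div, Finset.sum_add_distrib]
    linarith [sum_norm_sq_row_le hP i, sum_norm_sq_col_le hR i]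
  have hDcol : ∀ j, ∑ i, D i j ≤ 1 := fun j => by
    simp only [hD]
    rw [← Finset.sum_div, Finset.sum_add_distrib]
    linarith [sum_norm_sq_col_le hP j, sum_norm_sq_row_le hR j]
  have htrace : (M * Y * diagonal (fun j => (t j : ℂ)) * Z).trace =
      ∑ i, ∑ j, (s i : ℂ) * P i j * t j * R j i := by
    have h1 : M * Y * diagonal (fun j => (t j : ℂ)) * Z =
        U * (diagonal (fun i => (s i : ℂ)) * P * (diagonal (fun j => (t j : ℂ)) * Z)) := by
      rw [hMU, hPdef]; simp only [Matrix.mul_assoc]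
    rw [h1, Matrix.trace_mul_comm, Matrix.mul_assoc, Matrix.mul_assoc (diagonal _) Z U, ← hRdef,
      Matrix.trace]
    refine Finset.sum_congr rfl fun i _ => ?_
    rw [diag_apply, Matrix.mul_apply]
    refine Finset.sum_congr rfl fun j _ => ?_
    rw [diagonal_mul, diagonal_mul]
    ring
  have hbound : ‖(M * Y * diagonal (fun j => (t j : ℂ)) * Z).trace‖ ≤
      ∑ x : n × n, (D x.1 x.2 * r x.2) * (s x.1 * r x.2 ^ (-p⁻¹)) := by
    rw [htrace, Fintype.sum_prod_type]
    refine (norm_sum_le _ _).trans (Finset.sum_le_sum fun i _ => (norm_sum_le _ _).trans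
      (Finset.sum_le_sum fun j _ => ?_))
    rw [norm_mul, norm_mul, norm_mul, Complex.norm_real, Complex.norm_real,
      Real.norm_of_nonneg (hs i), Real.norm_of_nonneg (ht0 j)]
    have h1 : t j = r j * r j ^ (-p⁻¹) := by
      simp only [ht, supPow]
      split_ifs with h
      · rw [h, zero_mul]
      · rw [sub_eq_add_neg, Real.rpow_add ((hr j).lt_of_ne' h), Real.rpow_one]
    have h2 : ‖P i j‖ * ‖R j i‖ ≤ D i j := by
      simp only [hD]
      nlinarith [sq_nonneg (‖P i j‖ - ‖R j i‖)]
    calc s i * ‖P i j‖ * t j * ‖R j i‖ = (s i * t j) * (‖P i j‖ * ‖R j i‖) := by ring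
      _ ≤ (s i * t j) * D i j := mul_le_mul_of_nonneg_left h2 (mul_nonneg (hs i) (ht0 j))
      _ = _ := by rw [h1]; ring
  refine hbound.trans ((Real.inner_le_weight_mul_Lp_of_nonneg _ hp _ _
    (fun x => mul_nonneg (hD0 _ _) (hr _))
    (fun x => mul_nonneg (hs _) (Real.rpow_nonneg (hr _) _))).trans ?_)
  rw [mul_comm]
  have hpinv : 0 ≤ 1 - p⁻¹ := sub_nonneg.2 (inv_le_one_of_one_le₀ hp)
  refine mul_le_mul (Real.rpow_le_rpow (Finset.sum_nonneg fun x _ => ?_) ?_ (by positivity))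
    (Real.rpow_le_rpow (Finset.sum_nonneg fun x _ => mul_nonneg (hD0 _ _) (hr _)) ?_ hpinv)
    (Real.rpow_nonneg (Finset.sum_nonneg fun x _ => mul_nonneg (hD0 _ _) (hr _)) _)
    (Real.rpow_nonneg (Finset.sum_nonneg fun i _ => Real.rpow_nonneg (hs i) _) _)
  · exact mul_nonneg (mul_nonneg (hD0 _ _) (hr _))
      (Real.rpow_nonneg (mul_nonneg (hs _) (Real.rpow_nonneg (hr _) _)) _)
  · rw [Fintype.sum_prod_type]
    refine Finset.sum_le_sum fun i _ => ?_
    calc ∑ j, D i j * r j * (s i * r j ^ (-p⁻¹)) ^ p ≤ ∑ j, D i j * s i ^ p := by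
          refine Finset.sum_le_sum fun j _ => ?_
          rcases (hr j).eq_or_lt with h | h
          · rw [← h, mul_zero, zero_mul]
            exact mul_nonneg (hD0 _ _) (Real.rpow_nonneg (hs i) _)
          · rw [Real.mul_rpow (hs i) (Real.rpow_nonneg h.le _), ← Real.rpow_mul h.le,
              neg_mul, inv_mul_cancel₀ hp0.ne', Real.rpow_neg_one]
            apply le_of_eq
            field_simp
      _ = (∑ j, D i j) * s i ^ p := by rw [Finset.sum_mul]
      _ ≤ 1 * s i ^ p := mul_le_mul_of_nonneg_right (hDrow i) (Real.rpow_nonneg (hs i) _)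
      _ = _ := one_mul _
  · rw [Fintype.sum_prod_type_right]
    refine Finset.sum_le_sum fun j _ => ?_
    simp only
    rw [← Finset.sum_mul]
    exact (mul_le_mul_of_nonneg_right (hDcol j) (hr j)).trans_eq (one_mul _)
theorem norm_trace_exp_le_schatten {p q : ℝ} (hp : p ≠ 0) (hq : 1 ≤ q) (X V Z : Matrix n n ℂ)
    (hV : ‖V‖ ≤ 1) (hZ : ‖Z‖ ≤ 1) (a b s : n → ℝ) (hs : ∀ j, 0 ≤ s j) (c d : ℝ) (z : ℂ)
    (hz : c + z.re * d = p * (1 - q⁻¹)) :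
    ‖(X * diagonal (fun k => Complex.exp (a k + z * b k)) * V *
      diagonal (fun j => if s j = 0 then (0 : ℂ) else
        Complex.exp ((c + z * d) * Real.log (s j))) * Z).trace‖ ≤
      schattenSum q (X * diagonal fun k => ((Real.exp (a k + z.re * b k) : ℝ) : ℂ)) ^ q⁻¹ *
        (∑ j, s j ^ p) ^ (1 - q⁻¹) := by
  have hphase : ∀ y : n → ℝ,
      ‖(diagonal (fun k => Complex.exp (y k * Complex.I)) : Matrix n n ℂ)‖ ≤ 1 := fun y => by
    rw [l2_opNorm_diagonal, pi_norm_le_iff_of_nonneg zero_le_one]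
    intro k
    rw [Complex.norm_exp_ofReal_mul_I]
  have hleft : diagonal (fun k => Complex.exp (a k + z * b k)) =
      diagonal (fun k => ((Real.exp (a k + z.re * b k) : ℝ) : ℂ)) *
        diagonal (fun k => Complex.exp ((z.im * b k : ℝ) * Complex.I)) := by
    rw [diagonal_mul_diagonal]
    congr 1
    ext k
    rw [Complex.ofReal_exp, ← Complex.exp_add]
    congr 1
    conv_lhs => rw [← Complex.re_add_im z]
    push_cast
    ring
  have hright : diagonal (fun j => if s j = 0 then (0 : ℂ) else
        Complex.exp ((c + z * d) * Real.log (s j))) =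
      diagonal (fun j => Complex.exp ((z.im * d * Real.log (s j) : ℝ) * Complex.I)) *
        diagonal (fun j => (supPow (s j ^ p) (1 - q⁻¹) : ℂ)) := by
    rw [diagonal_mul_diagonal]
    congr 1
    ext j
    by_cases h : s j = 0
    · simp [h, supPow, Real.zero_rpow hp]
    · have hpos : 0 < s j := (hs j).lt_of_ne' h
      have hpp : s j ^ p ≠ 0 := (Real.rpow_pos_of_pos hpos p).ne'
      rw [if_neg h, supPow, if_neg hpp, ← Real.rpow_mul hpos.le, ← hz,
        Real.rpow_def_of_pos hpos, Complex.ofReal_exp, ← Complex.exp_add]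
      congr 1
      conv_lhs => rw [← Complex.re_add_im z]
      push_cast
      ring
  have hmul : ∀ {M N : Matrix n n ℂ}, ‖M‖ ≤ 1 → ‖N‖ ≤ 1 → ‖M * N‖ ≤ 1 := fun hM hN =>
    (l2_opNorm_mul _ _).trans (mul_le_one₀ hM (norm_nonneg _) hN)
  have h := norm_trace_mul_le_schatten hq
    (X * diagonal fun k => ((Real.exp (a k + z.re * b k) : ℝ) : ℂ))
    (diagonal (fun k => Complex.exp ((z.im * b k : ℝ) * Complex.I)) * V *
      diagonal (fun j => Complex.exp ((z.im * d * Real.log (s j) : ℝ) * Complex.I))) Z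
    (hmul (hmul (hphase _) hV) (hphase _)) hZ (fun j => s j ^ p)
    fun j => Real.rpow_nonneg (hs j) _
  rw [hleft, hright]
  simpa only [Matrix.mul_assoc] using h

theorem trace_mul_diagonal_mul_diagonal_mul (X V Z : Matrix n n ℂ) (f g : n → ℂ) :
    (X * diagonal f * V * diagonal g * Z).trace =
      ∑ j, ∑ k, (Z * X) j k * V k j * (f k * g j) := by
  rw [Matrix.trace_mul_comm, Matrix.trace]
  refine Finset.sum_congr rfl fun j _ => ?_
  rw [diag_apply, ← Matrix.mul_assoc, mul_diagonal, ← Matrix.mul_assoc, ← Matrix.mul_assoc,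
    Matrix.mul_apply, Finset.sum_mul]
  refine Finset.sum_congr rfl fun k _ => ?_
  rw [mul_diagonal]
  ring

/-- Complex interpolation for the Schatten norms of a matrix with exponentially rescaled
columns. -/
theorem schatten_interpolation {p₀ p₁ p θ : ℝ} (hp₀ : 1 ≤ p₀) (hp₁ : 1 ≤ p₁) (hp : 1 ≤ p)
    (hθ₀ : 0 ≤ θ) (hθ₁ : θ ≤ 1) (hinv : p⁻¹ = (1 - θ) * p₀⁻¹ + θ * p₁⁻¹) (X : Matrix n n ℂ)
    (l₀ l₁ : n → ℝ) :
    schattenSum p (X * diagonal fun k => ((Real.exp ((1 - θ) * l₀ k + θ * l₁ k) : ℝ) : ℂ)) ^ p⁻¹ ≤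
      (schattenSum p₀ (X * diagonal fun k => ((Real.exp (l₀ k) : ℝ) : ℂ)) ^ p₀⁻¹) ^ (1 - θ) *
      (schattenSum p₁ (X * diagonal fun k => ((Real.exp (l₁ k) : ℝ) : ℂ)) ^ p₁⁻¹) ^ θ := by
  have hp0 : 0 < p := by linarith
  set W := X * diagonal fun k => ((Real.exp ((1 - θ) * l₀ k + θ * l₁ k) : ℝ) : ℂ) with hW
  set N₀ := schattenSum p₀ (X * diagonal fun k => ((Real.exp (l₀ k) : ℝ) : ℂ)) with hN₀
  set N₁ := schattenSum p₁ (X * diagonal fun k => ((Real.exp (l₁ k) : ℝ) : ℂ)) with hN₁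
  have hN₀0 : 0 ≤ N₀ := schattenSum_nonneg (by linarith) _
  have hN₁0 : 0 ≤ N₁ := schattenSum_nonneg (by linarith) _
  obtain ⟨U, V, s, hs, hU, hV, hWU, hUU, hWW⟩ := exists_singular_value_decomposition W
  rw [schattenSum_eq_sum hp0.ne' hs hV hWW]
  set N := ∑ i, s i ^ p with hN
  have hN0 : 0 ≤ N := Finset.sum_nonneg fun i _ => Real.rpow_nonneg (hs i) _
  rcases hN0.eq_or_lt with hNz | hNpos
  · rw [← hNz, Real.zero_rpow (inv_ne_zero hp0.ne')]
    exact mul_nonneg (Real.rpow_nonneg (Real.rpow_nonneg hN₀0 _) _)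
      (Real.rpow_nonneg (Real.rpow_nonneg hN₁0 _) _)
  have hV1 : star V * V = 1 := (Matrix.mem_unitaryGroup_iff').1 hV
  have hVn : ‖V‖ ≤ 1 := norm_le_one_of_mem_unitaryGroup hV
  have hUn : ‖Uᴴ‖ ≤ 1 := by rwa [l2_opNorm_conjTranspose]
  set c := p * (1 - p₀⁻¹) with hc
  set d := p * (p₀⁻¹ - p₁⁻¹) with hd
  set e₁ : n → ℂ → ℂ := fun k z => Complex.exp (l₀ k + z * (l₁ k - l₀ k : ℝ)) with he₁
  set e₂ : n → ℂ → ℂ := fun j z =>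
    if s j = 0 then (0 : ℂ) else Complex.exp ((c + z * d) * Real.log (s j)) with he₂
  set f : ℂ → ℂ := fun z =>
    (X * diagonal (fun k => e₁ k z) * V * diagonal (fun j => e₂ j z) * Uᴴ).trace with hf
  have hfsum : f = fun z => ∑ j, ∑ k, (Uᴴ * X) j k * V k j * (e₁ k z * e₂ j z) :=
    funext fun z => trace_mul_diagonal_mul_diagonal_mul _ _ _ _ _
  have hdiff : Differentiable ℂ f := by
    rw [hfsum]
    refine Differentiable.fun_sum fun j _ => Differentiable.fun_sum fun k _ => ?_
    have h1 : Differentiable ℂ (e₁ k) := by simp only [he₁]; fun_prop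
    have h2 : Differentiable ℂ (e₂ j) := by
      simp only [he₂]
      split_ifs <;> fun_prop
    exact (h1.mul h2).const_mul _
  have hexp : ∀ (u v : ℝ) (z : ℂ), z.re ∈ Set.Icc (0 : ℝ) 1 →
      ‖Complex.exp (u + z * v)‖ ≤ Real.exp (|u| + |v|) := fun u v z hz => by
    rw [Complex.norm_exp]
    refine Real.exp_le_exp.2 ?_
    simp only [Complex.add_re, Complex.ofReal_re, Complex.mul_re, Complex.ofReal_im, mul_zero,
      sub_zero]
    have h1 : z.re * v ≤ 1 * |v| := (mul_le_mul_of_nonneg_left (le_abs_self v) hz.1).trans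
      (mul_le_mul_of_nonneg_right hz.2 (abs_nonneg v))
    linarith [le_abs_self u]
  have hbdd : BddAbove ((norm ∘ f) '' Complex.HadamardThreeLines.verticalClosedStrip 0 1) := by
    refine ⟨∑ j, ∑ k, ‖(Uᴴ * X) j k * V k j‖ * (Real.exp (|l₀ k| + |l₁ k - l₀ k|) *
      Real.exp (|c * Real.log (s j)| + |d * Real.log (s j)|)), ?_⟩
    rintro _ ⟨z, hz, rfl⟩
    rw [Function.comp_apply, hfsum]
    refine (norm_sum_le _ _).trans (Finset.sum_le_sum fun j _ => (norm_sum_le _ _).trans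
      (Finset.sum_le_sum fun k _ => ?_))
    rw [norm_mul, norm_mul (e₁ k z)]
    refine mul_le_mul_of_nonneg_left (mul_le_mul (hexp _ _ _ hz) ?_ (norm_nonneg _)
      (Real.exp_pos _).le) (norm_nonneg _)
    simp only [he₂]
    split_ifs
    · rw [norm_zero]
      positivity
    · have h2 : ((c : ℂ) + z * d) * Real.log (s j) =
          (c * Real.log (s j) : ℝ) + z * (d * Real.log (s j) : ℝ) := by
        push_cast
        ring
      rw [h2]
      exact hexp _ _ z hz
  have hmem : (θ : ℂ) ∈ Complex.HadamardThreeLines.verticalClosedStrip 0 1 := by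
    simp [Complex.HadamardThreeLines.verticalClosedStrip, hθ₀, hθ₁]
  have hthree := Complex.HadamardThreeLines.norm_le_interp_of_mem_verticalClosedStrip₀₁' f
    (a := N₀ ^ p₀⁻¹ * N ^ (1 - p₀⁻¹)) (b := N₁ ^ p₁⁻¹ * N ^ (1 - p₁⁻¹)) hmem
    hdiff.diffContOnCl hbdd
    (fun z hz => by
      have hre : z.re = 0 := hz
      have h := norm_trace_exp_le_schatten hp0.ne' hp₀ X V Uᴴ hVn hUn l₀
        (fun k => l₁ k - l₀ k) s hs c d z (by rw [hre, hc]; ring)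
      simpa only [hre, zero_mul, add_zero] using h)
    (fun z hz => by
      have hre : z.re = 1 := hz
      have h := norm_trace_exp_le_schatten hp0.ne' hp₁ X V Uᴴ hVn hUn l₀
        (fun k => l₁ k - l₀ k) s hs c d z (by rw [hre, hc, hd]; ring)
      simpa only [hre, one_mul, add_sub_cancel] using h)
  have hfθ : f θ = (N : ℂ) := by
    have h1 : X * diagonal (fun k => e₁ k θ) = W := by
      rw [hW]
      congr 2
      ext k
      simp only [he₁]
      push_cast
      congr 1
      ring
    simp only [hf]
    rw [h1, hWU, Matrix.mul_assoc _ (star V) V, hV1, Matrix.mul_one, Matrix.trace_mul_comm,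
      ← Matrix.mul_assoc, ← Matrix.mul_assoc, hUU, diagonal_mul_diagonal, diagonal_mul_diagonal,
      trace_diagonal, hN]
    push_cast
    refine Finset.sum_congr rfl fun j _ => ?_
    simp only [he₂]
    split_ifs with h
    · simp [h, Real.zero_rpow hp0.ne']
    · have hpos : 0 < s j := (hs j).lt_of_ne' h
      have hexpo : c + θ * d = p - 1 := by
        have : c + θ * d = p * (1 - ((1 - θ) * p₀⁻¹ + θ * p₁⁻¹)) := by rw [hc, hd]; ring
        rw [this, ← hinv]
        field_simp
      have h2 : ((c : ℂ) + θ * d) * Real.log (s j) = ((Real.log (s j) * (p - 1) : ℝ) : ℂ) := by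
        rw [← hexpo]
        push_cast
        ring
      rw [h2, ← Complex.ofReal_exp, ← Real.rpow_def_of_pos hpos, one_mul, ← Complex.ofReal_mul]
      congr 1
      rw [Real.rpow_sub_one h]
      field_simp
  rw [hfθ, Complex.norm_real, Real.norm_of_nonneg hN0, Complex.ofReal_re,
    Real.mul_rpow (Real.rpow_nonneg hN₀0 _) (Real.rpow_nonneg hN0 _),
    Real.mul_rpow (Real.rpow_nonneg hN₁0 _) (Real.rpow_nonneg hN0 _), ← Real.rpow_mul hN0,
    ← Real.rpow_mul hN0] at hthree
  have hcomb : N ^ ((1 - p₀⁻¹) * (1 - θ)) * N ^ ((1 - p₁⁻¹) * θ) = N ^ (1 - p⁻¹) := by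
    rw [← Real.rpow_add hNpos]
    congr 1
    rw [hinv]
    ring
  have hsplit : N = N ^ p⁻¹ * N ^ (1 - p⁻¹) := by
    rw [← Real.rpow_add hNpos]
    simp
  have hfin : N ^ p⁻¹ * N ^ (1 - p⁻¹) ≤
      ((N₀ ^ p₀⁻¹) ^ (1 - θ) * (N₁ ^ p₁⁻¹) ^ θ) * N ^ (1 - p⁻¹) := by
    rw [← hsplit, ← hcomb]
    refine hthree.trans_eq ?_
    ring
  exact le_of_mul_le_mul_right hfin (Real.rpow_pos_of_pos hNpos _)

/-- Log-convexity form of `schatten_interpolation`. -/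
theorem log_schatten_interpolation {p₀ p₁ p θ : ℝ} (hp₀ : 1 ≤ p₀) (hp₁ : 1 ≤ p₁) (hp : 1 ≤ p)
    (hθ₀ : 0 ≤ θ) (hθ₁ : θ ≤ 1) (hinv : p⁻¹ = (1 - θ) * p₀⁻¹ + θ * p₁⁻¹) {X : Matrix n n ℂ}
    (hX : X ≠ 0) (l₀ l₁ l : n → ℝ) (hl : ∀ k, l k = (1 - θ) * l₀ k + θ * l₁ k) :
    p⁻¹ * Real.logb 2 (schattenSum p (X * diagonal fun k => ((Real.exp (l k) : ℝ) : ℂ))) ≤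
      (1 - θ) * (p₀⁻¹ *
        Real.logb 2 (schattenSum p₀ (X * diagonal fun k => ((Real.exp (l₀ k) : ℝ) : ℂ)))) +
      θ * (p₁⁻¹ *
        Real.logb 2 (schattenSum p₁ (X * diagonal fun k => ((Real.exp (l₁ k) : ℝ) : ℂ)))) := by
  have hne : ∀ l : n → ℝ, X * diagonal (fun k => ((Real.exp (l k) : ℝ) : ℂ)) ≠ 0 := by
    intro l h
    refine hX (Matrix.ext fun i k => ?_)
    have := congrFun (congrFun h i) k
    rw [mul_diagonal, Matrix.zero_apply] at this
    exact (mul_eq_zero.1 this).resolve_right (Complex.ofReal_ne_zero.2 (Real.exp_pos _).ne')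
  have h := schatten_interpolation hp₀ hp₁ hp hθ₀ hθ₁ hinv X l₀ l₁
  have hpos := schattenSum_pos (p := p) (by linarith) (hne l)
  have hpos₀ := schattenSum_pos (p := p₀) (by linarith) (hne l₀)
  have hpos₁ := schattenSum_pos (p := p₁) (by linarith) (hne l₁)
  simp only [← hl] at h
  generalize schattenSum p (X * diagonal fun k => ((Real.exp (l k) : ℝ) : ℂ)) = N at h hpos ⊢
  generalize schattenSum p₀ (X * diagonal fun k => ((Real.exp (l₀ k) : ℝ) : ℂ)) = N₀ at h hpos₀ ⊢
  generalize schattenSum p₁ (X * diagonal fun k => ((Real.exp (l₁ k) : ℝ) : ℂ)) = N₁ at h hpos₁ ⊢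
  have hlog := Real.logb_le_logb_of_le one_lt_two (Real.rpow_pos_of_pos hpos _) h
  rwa [Real.logb_mul (by positivity) (by positivity), Real.logb_rpow_eq_mul_logb_of_pos hpos,
    Real.logb_rpow_eq_mul_logb_of_pos (by positivity),
    Real.logb_rpow_eq_mul_logb_of_pos (by positivity),
    Real.logb_rpow_eq_mul_logb_of_pos (by positivity),
    Real.logb_rpow_eq_mul_logb_of_pos (by positivity)] at hlog

end Schatten

section Rotated

variable {n : Type*} [Fintype n] [DecidableEq n]

theorem trace_conjTranspose_mul_self_mul_conj_diagonal (X V : Matrix n n ℂ) (g : n → ℝ) :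
    (Xᴴ * X * (V * diagonal (fun k => (g k : ℂ)) * star V)).trace =
      ((∑ k, (∑ i, ‖(X * V) i k‖ ^ 2) * g k : ℝ) : ℂ) := by
  have h : (Xᴴ * X * (V * diagonal (fun k => (g k : ℂ)) * star V)).trace =
      ((X * V)ᴴ * (X * V) * diagonal (fun k => (g k : ℂ))).trace := by
    rw [← Matrix.mul_assoc, Matrix.trace_mul_comm, conjTranspose_mul, star_eq_conjTranspose]
    simp only [Matrix.mul_assoc]
  rw [h, Matrix.trace]
  push_cast
  refine Finset.sum_congr rfl fun k _ => ?_
  rw [diag_apply, mul_diagonal, Matrix.mul_apply]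
  congr 1
  refine Finset.sum_congr rfl fun i _ => ?_
  rw [conjTranspose_apply, RCLike.star_def, Complex.conj_mul']

theorem trace_sandwich_eq_schattenSum {V : Matrix n n ℂ} (hV : V ∈ Matrix.unitaryGroup n ℂ)
    (X : Matrix n n ℂ) (κ : n → ℝ) (r a : ℝ) :
    (matPow (matPow (V * diagonal (fun k => (κ k : ℂ)) * star V) r * (Xᴴ * X) *
      matPow (V * diagonal (fun k => (κ k : ℂ)) * star V) r) a).trace.re =
      schattenSum (2 * a) (X * V * diagonal fun k => (supPow (κ k) r : ℂ)) := by
  set Y := X * V * diagonal fun k => (supPow (κ k) r : ℂ) with hY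
  have hd : (diagonal fun k => (supPow (κ k) r : ℂ) : Matrix n n ℂ)ᴴ =
      diagonal fun k => (supPow (κ k) r : ℂ) := by
    rw [diagonal_conjTranspose]
    congr 1
    ext k
    simp
  have h : matPow (V * diagonal (fun k => (κ k : ℂ)) * star V) r * (Xᴴ * X) *
      matPow (V * diagonal (fun k => (κ k : ℂ)) * star V) r = V * (Yᴴ * Y) * star V := by
    rw [matPow_unitary_conj _ hV, hY, conjTranspose_mul, conjTranspose_mul, hd,
      star_eq_conjTranspose]
    simp only [Matrix.mul_assoc]
  rw [h, trace_matPow_unitary_conj _ hV (isHermitian_conjTranspose_mul_self Y), schattenSum,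
    mul_div_cancel_left₀ _ two_ne_zero]

theorem Dominates.column_eq_zero {V X : Matrix n n ℂ} (hV : V ∈ Matrix.unitaryGroup n ℂ)
    {κ : n → ℝ} (h : Dominates (V * diagonal (fun k => (κ k : ℂ)) * star V) (Xᴴ * X)) {k : n}
    (hk : κ k = 0) (i : n) : (X * V) i k = 0 := by
  have hV1 : star V * V = 1 := (Matrix.mem_unitaryGroup_iff').1 hV
  have hv := h (V *ᵥ Pi.single k 1) (by
    rw [mulVec_mulVec, Matrix.mul_assoc, hV1, Matrix.mul_one, ← mulVec_mulVec,
      diagonal_mulVec_single, hk]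
    simp)
  rw [conjTranspose_mul_self_mulVec_eq_zero X, mulVec_mulVec] at hv
  simpa using congrFun hv i

theorem dominates_of_column_eq_zero {V X : Matrix n n ℂ} (hV : V ∈ Matrix.unitaryGroup n ℂ)
    {κ : n → ℝ} (h : ∀ k, κ k = 0 → ∀ i, (X * V) i k = 0) :
    Dominates (V * diagonal (fun k => (κ k : ℂ)) * star V) (Xᴴ * X) := by
  intro v hv
  have hV1 : star V * V = 1 := (Matrix.mem_unitaryGroup_iff').1 hV
  have hV2 : V * star V = 1 := (Matrix.mem_unitaryGroup_iff).1 hV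
  have hw : diagonal (fun k => (κ k : ℂ)) *ᵥ (star V *ᵥ v) = 0 := by
    have := congrArg (fun x => star V *ᵥ x) hv
    simpa only [mulVec_mulVec, ← Matrix.mul_assoc, hV1, Matrix.one_mul, mulVec_zero] using this
  have hX : X *ᵥ v = 0 := by
    have h1 : X *ᵥ v = (X * V) *ᵥ (star V *ᵥ v) := by
      rw [mulVec_mulVec, Matrix.mul_assoc, hV2, Matrix.mul_one]
    rw [h1]
    ext i
    rw [mulVec, dotProduct]
    refine Finset.sum_eq_zero fun k _ => ?_
    have hk := congrFun hw k
    rw [mulVec_diagonal, Pi.zero_apply, mul_eq_zero] at hk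
    rcases hk with hk | hk
    · rw [h k (Complex.ofReal_eq_zero.1 hk), zero_mul]
    · rw [hk, mul_zero]
  rw [← mulVec_mulVec, hX, mulVec_zero]

end Rotated

theorem unitary_conj_diagonal_kronecker {A B : Type*} [Fintype A] [Fintype B] [DecidableEq A]
    [DecidableEq B] (U : Matrix A A ℂ) (V : Matrix B B ℂ) (s : A → ℝ)
    (t : B → ℝ) :
    (U * diagonal (fun a => (s a : ℂ)) * star U) ⊗ₖ (V * diagonal (fun b => (t b : ℂ)) * star V) =
      (U ⊗ₖ V) * diagonal (fun k : A × B => ((s k.1 * t k.2 : ℝ) : ℂ)) * star (U ⊗ₖ V) := by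
  rw [mul_kronecker_mul, mul_kronecker_mul, diagonal_kronecker_diagonal, star_eq_conjTranspose,
    star_eq_conjTranspose, star_eq_conjTranspose, conjTranspose_kronecker]
  simp only [Complex.ofReal_mul]

theorem trace_mul_one_kronecker {A B : Type*} [Fintype A] [Fintype B] [DecidableEq A]
    (ρ : Matrix (A × B) (A × B) ℂ) (M : Matrix B B ℂ) :
    (ρ * ((1 : Matrix A A ℂ) ⊗ₖ M)).trace = (margSnd ρ * M).trace := by
  simp only [Matrix.trace, diag_apply, Matrix.mul_apply, margSnd, Matrix.of_apply,
    kroneckerMap_apply, Fintype.sum_prod_type, Finset.sum_mul]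
  rw [Finset.sum_comm]
  refine Finset.sum_congr rfl fun b _ => ?_
  rw [Finset.sum_comm (s := (Finset.univ : Finset B))]
  refine Finset.sum_congr rfl fun a _ => ?_
  rw [Finset.sum_eq_single a]
  · simp
  · intro a' _ ha'
    simp [one_apply_ne ha']
  · simp

theorem isHermitian_margSnd {A B : Type*} [Fintype A] {ρ : Matrix (A × B) (A × B) ℂ}
    (hρ : ρ.IsHermitian) :
    (margSnd ρ).IsHermitian := by
  ext b b'
  simp only [margSnd, conjTranspose_apply, Matrix.of_apply, star_sum]
  exact Finset.sum_congr rfl fun a _ => hρ.apply _ _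

theorem supPow_eq_exp {x : ℝ} (hx : 0 < x) (r : ℝ) : supPow x r = Real.exp (r * Real.log x) := by
  rw [supPow, if_neg hx.ne', Real.rpow_def_of_pos hx, mul_comm]

theorem supPow_nonneg {x : ℝ} (hx : 0 ≤ x) (r : ℝ) : 0 ≤ supPow x r := by
  rw [supPow]
  split_ifs
  exacts [le_rfl, Real.rpow_nonneg hx r]

theorem renyi_parameter_cases {α β γ : ℝ} (hα : 0 < α) (hβ : 1 / 2 ≤ β)
    (hγ : 1 / 2 ≤ γ) (hα1 : α ≠ 1) (hβ1 : β ≠ 1) (hγ1 : γ ≠ 1)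
    (hrel : α / (α - 1) = β / (β - 1) + γ / (γ - 1))
    (hsign : (α - 1) * (β - 1) * (γ - 1) < 0) :
    (1 < α ∧ β < 1 ∧ 1 < γ) ∨ (1 < α ∧ 1 < β ∧ γ < 1) ∨
      (1 / 2 ≤ α ∧ α < 1 ∧ β < 1 ∧ γ < 1) := by
  have hneg : ∀ x : ℝ, 1 / 2 ≤ x → x < 1 → x / (x - 1) ≤ -1 := fun x h1 h2 => by
    rw [div_le_iff_of_neg (by linarith)]
    linarith
  have hpos : ∀ x : ℝ, 1 < x → 0 < x / (x - 1) := fun x h =>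
    div_pos (by linarith) (by linarith)
  rcases lt_or_gt_of_ne hα1 with ha | ha <;> rcases lt_or_gt_of_ne hβ1 with hb | hb <;>
    rcases lt_or_gt_of_ne hγ1 with hc | hc
  · refine Or.inr (Or.inr ⟨?_, ha, hb, hc⟩)
    have h : α / (α - 1) ≤ -1 := by linarith [hneg β hβ hb, hneg γ hγ hc]
    rw [div_le_iff_of_neg (by linarith)] at h
    linarith
  · have := mul_pos (mul_pos_of_neg_of_neg (sub_neg.2 ha) (sub_neg.2 hb)) (sub_pos.2 hc)
    linarith
  · have := mul_pos_of_neg_of_neg (mul_neg_of_neg_of_pos (sub_neg.2 ha) (sub_pos.2 hb))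
      (sub_neg.2 hc)
    linarith
  · have := div_neg_of_pos_of_neg hα (sub_neg.2 ha)
    linarith [hpos β hb, hpos γ hc]
  · have := mul_pos_of_neg_of_neg (mul_neg_of_pos_of_neg (sub_pos.2 ha) (sub_neg.2 hb))
      (sub_neg.2 hc)
    linarith
  · exact Or.inl ⟨ha, hb, hc⟩
  · exact Or.inr (Or.inl ⟨ha, hb, hc⟩)
  · have := mul_pos (mul_pos (sub_pos.2 ha) (sub_pos.2 hb)) (sub_pos.2 hc)
    linarith

theorem renyi_interpolation {n : Type*} [Fintype n] [DecidableEq n] {α β γ : ℝ} (hα : 0 < α)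
    (hβ : 1 / 2 ≤ β) (hγ : 1 / 2 ≤ γ) (hα1 : α ≠ 1) (hβ1 : β ≠ 1) (hγ1 : γ ≠ 1)
    (hrel : α / (α - 1) = β / (β - 1) + γ / (γ - 1))
    (hsign : (α - 1) * (β - 1) * (γ - 1) < 0) {X : Matrix n n ℂ} (hX : X ≠ 0) (x y : n → ℝ)
    {m : ℝ} (hm : Real.logb 2 (schattenSum 2 (X * diagonal fun k =>
      ((Real.exp ((β - 1) / (2 * β) * y k) : ℝ) : ℂ))) ≤ m)
    (hm' : ¬ α < 1 → Real.logb 2 (schattenSum 2 (X * diagonal fun k =>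
      ((Real.exp ((β - 1) / (2 * β) * y k) : ℝ) : ℂ))) = m) :
    (γ - 1)⁻¹ * Real.logb 2 (schattenSum (2 * γ) (X * diagonal fun k =>
        ((Real.exp ((1 - γ) / (2 * γ) * (x k + y k)) : ℝ) : ℂ))) ≤
      β / (1 - β) * m + (α - 1)⁻¹ * Real.logb 2 (schattenSum (2 * α) (X * diagonal fun k =>
        ((Real.exp ((1 - α) / (2 * α) * x k) : ℝ) : ℂ))) := by
  have hcases := renyi_parameter_cases hα hβ hγ hα1 hβ1 hγ1 hrel hsign
  have hβpos : 0 < β := by linarith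
  have hγpos : 0 < γ := by linarith
  have hα1' : α - 1 ≠ 0 := sub_ne_zero.2 hα1
  have hβ1' : β - 1 ≠ 0 := sub_ne_zero.2 hβ1
  have hγ1' : γ - 1 ≠ 0 := sub_ne_zero.2 hγ1
  obtain ⟨a, ha⟩ : ∃ a, a = α / (α - 1) := ⟨_, rfl⟩
  obtain ⟨b, hb⟩ : ∃ b, b = β / (β - 1) := ⟨_, rfl⟩
  obtain ⟨c, hc⟩ : ∃ c, c = γ / (γ - 1) := ⟨_, rfl⟩
  rw [← ha, ← hb, ← hc] at hrel
  have ha0 : a ≠ 0 := ha ▸ div_ne_zero hα.ne' hα1'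
  have hb0 : b ≠ 0 := hb ▸ div_ne_zero hβpos.ne' hβ1'
  have hc0 : c ≠ 0 := hc ▸ div_ne_zero hγpos.ne' hγ1'
  have hainv : α⁻¹ = 1 - a⁻¹ := by rw [ha, inv_div]; field_simp; ring
  have hcinv : γ⁻¹ = 1 - c⁻¹ := by rw [hc, inv_div]; field_simp; ring
  have hea : (1 - α) / (2 * α) = -(a⁻¹ / 2) := by rw [ha, inv_div]; field_simp; ring
  have heb : (β - 1) / (2 * β) = b⁻¹ / 2 := by rw [hb, inv_div]; field_simp
  have hec : (1 - γ) / (2 * γ) = -(c⁻¹ / 2) := by rw [hc, inv_div]; field_simp; ring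
  rw [hea, hec]
  rw [heb] at hm hm'
  have hA := log_schatten_interpolation (X := X) (p₀ := 2) (p₁ := 2 * α) (p := 2 * γ)
    (θ := a / c) one_le_two
  have hB := log_schatten_interpolation (X := X) (p₀ := 2 * γ) (p₁ := 2 * α) (p := 2)
    (θ := a / b)
  have hC := log_schatten_interpolation (X := X) (p₀ := 2) (p₁ := 2 * γ) (p := 2 * α)
    (θ := c / a) one_le_two
  suffices hgoal : c * ((2 * γ)⁻¹ * Real.logb 2 (schattenSum (2 * γ) (X * diagonal fun k =>
        ((Real.exp (-(c⁻¹ / 2) * (x k + y k)) : ℝ) : ℂ)))) ≤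
      -(b * (2⁻¹ * m)) + a * ((2 * α)⁻¹ * Real.logb 2 (schattenSum (2 * α) (X * diagonal fun k =>
        ((Real.exp (-(a⁻¹ / 2) * x k) : ℝ) : ℂ)))) by
    have h1 : ∀ L, c * ((2 * γ)⁻¹ * L) = 2⁻¹ * ((γ - 1)⁻¹ * L) := fun L => by
      rw [hc]; field_simp
    have h2 : -(b * (2⁻¹ * m)) = 2⁻¹ * (β / (1 - β) * m) := by
      rw [hb, ← neg_sub β 1, div_neg]; ring
    have h3 : ∀ L, a * ((2 * α)⁻¹ * L) = 2⁻¹ * ((α - 1)⁻¹ * L) := fun L => by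
      rw [ha]; field_simp
    rw [h1, h2, h3] at hgoal
    linarith
  rcases hcases with ⟨hα', hβ', hγ'⟩ | ⟨hα', hβ', hγ'⟩ | ⟨hα₂, hα', hβ', hγ'⟩
  · have hapos : 0 < a := ha ▸ div_pos hα (by linarith)
    have hbneg : b < 0 := hb ▸ div_neg_of_pos_of_neg hβpos (by linarith)
    have hcpos : 0 < c := hc ▸ div_pos (by linarith) (by linarith)
    have h := hA (by linarith) (by linarith) (by positivity)
      ((div_le_one hcpos).2 (by linarith))
      (by rw [mul_inv, mul_inv, hainv, hcinv]; field_simp; linarith) hX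
      (fun k => b⁻¹ / 2 * y k) (fun k => -(a⁻¹ / 2) * x k) (fun k => -(c⁻¹ / 2) * (x k + y k))
      (fun k => by field_simp; rw [hrel]; ring)
    rw [hm' (by linarith)] at h
    have h2 := mul_le_mul_of_nonneg_left h hcpos.le
    refine h2.trans_eq ?_
    obtain rfl : b = a - c := by linarith
    field_simp
    ring
  · have hapos : 0 < a := ha ▸ div_pos hα (by linarith)
    have hbpos : 0 < b := hb ▸ div_pos hβpos (by linarith)
    have hcneg : c < 0 := hc ▸ div_neg_of_pos_of_neg (by linarith) (by linarith)
    have h := hB (by linarith) (by linarith) one_le_two (by positivity)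
      ((div_le_one hbpos).2 (by linarith))
      (by rw [mul_inv, mul_inv, hainv, hcinv]; field_simp; rw [hrel]; ring) hX
      (fun k => -(c⁻¹ / 2) * (x k + y k)) (fun k => -(a⁻¹ / 2) * x k) (fun k => b⁻¹ / 2 * y k)
      (fun k => by field_simp; rw [hrel]; ring)
    rw [hm' (by linarith)] at h
    have h2 := mul_le_mul_of_nonneg_left h hbpos.le
    have h3 : ∀ L M, b * ((1 - a / b) * L + a / b * M) = -(c * L) + a * M := fun L M => by
      obtain rfl : c = a - b := by linarith
      field_simp
      ring
    rw [h3] at h2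
    linarith
  · have haneg : a < 0 := ha ▸ div_neg_of_pos_of_neg hα (by linarith)
    have hbneg : b < 0 := hb ▸ div_neg_of_pos_of_neg hβpos (by linarith)
    have hcneg : c < 0 := hc ▸ div_neg_of_pos_of_neg (by linarith) (by linarith)
    have h := hC (by linarith) (by linarith) (div_nonneg_of_nonpos hcneg.le haneg.le)
      ((div_le_one_of_neg haneg).2 (by linarith))
      (by rw [mul_inv, mul_inv, hainv, hcinv]; field_simp; rw [hrel]; ring) hX
      (fun k => b⁻¹ / 2 * y k) (fun k => -(c⁻¹ / 2) * (x k + y k)) (fun k => -(a⁻¹ / 2) * x k)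
      (fun k => by field_simp; rw [hrel]; ring)
    have h2 := mul_le_mul_of_nonneg_left h (neg_nonneg.2 haneg.le)
    have h3 : ∀ L M, -a * ((1 - c / a) * L + c / a * M) = -(b * L) - c * M := fun L M => by
      obtain rfl : b = a - c := by linarith
      field_simp
      ring
    rw [h3, neg_mul] at h2
    have h4 := mul_le_mul_of_nonpos_left (mul_le_mul_of_nonneg_left hm
      (by norm_num : (0 : ℝ) ≤ 2⁻¹)) hbneg.le
    linarith

/-- The decomposition inequality for the matrix `Y = X V`, where `ρ = Xᴴ X` and `V` is a product
unitary that diagonalizes `σ_A` and `ρ_B` with eigenvalues `s` and `t`. -/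
theorem renyi_decomposition_diagonal {A B : Type*} [Fintype A] [Fintype B] [DecidableEq A]
    [DecidableEq B] {α β γ : ℝ} (hα : 0 < α) (hβ : 1 / 2 ≤ β)
    (hγ : 1 / 2 ≤ γ) (hα1 : α ≠ 1) (hβ1 : β ≠ 1) (hγ1 : γ ≠ 1)
    (hrel : α / (α - 1) = β / (β - 1) + γ / (γ - 1))
    (hsign : (α - 1) * (β - 1) * (γ - 1) < 0) (Y : Matrix (A × B) (A × B) ℂ) {s : A → ℝ}
    {t : B → ℝ} (hs : ∀ a, 0 ≤ s a) (ht : ∀ b, ∑ a, ∑ i, ‖Y i (a, b)‖ ^ 2 = t b) {Z : ℝ}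
    (hZ : Z = ∑ b, supPow (t b) β) (hZ0 : 0 < Z)
    (hne : ∃ i a b, Y i (a, b) ≠ 0 ∧ s a ≠ 0)
    (hdom : (∀ a, s a = 0 → ∀ i b, Y i (a, b) = 0) ∨ α < 1) :
    (γ - 1)⁻¹ * Real.logb 2 (schattenSum (2 * γ) (Y * diagonal fun k =>
        ((supPow (s k.1 * (supPow (t k.2) β / Z)) ((1 - γ) / (2 * γ)) : ℝ) : ℂ))) ≤
      (1 - β)⁻¹ * Real.logb 2 Z + (α - 1)⁻¹ * Real.logb 2 (schattenSum (2 * α)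
        (Y * diagonal fun k => ((supPow (s k.1) ((1 - α) / (2 * α)) : ℝ) : ℂ))) := by
  have hβpos : 0 < β := by linarith
  have hβ0 : β ≠ 0 := by linarith
  have hβ1' : β - 1 ≠ 0 := sub_ne_zero.2 hβ1
  have hY0 : ∀ k : A × B, t k.2 = 0 → ∀ i, Y i k = 0 := fun k hk i => by
    rw [← ht] at hk
    have h1 := (Finset.sum_eq_zero_iff_of_nonneg
      (fun a _ => Finset.sum_nonneg fun i _ => by positivity)).1 hk k.1 (Finset.mem_univ _)
    have h2 := (Finset.sum_eq_zero_iff_of_nonneg (fun i _ => by positivity)).1 h1 i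
      (Finset.mem_univ _)
    simpa using h2
  have ht0 : ∀ b, 0 ≤ t b := fun b => by
    rw [← ht]
    positivity
  set T : B → ℝ := fun b => supPow (t b) β / Z with hT
  have hTpos : ∀ b, t b ≠ 0 → 0 < T b := fun b hb => by
    simp only [hT, supPow, if_neg hb]
    exact div_pos (Real.rpow_pos_of_pos ((ht0 b).lt_of_ne' hb) _) hZ0
  set Y' : Matrix (A × B) (A × B) ℂ := Matrix.of fun i k => if s k.1 = 0 then 0 else Y i k with hY'
  have hY'0 : Y' ≠ 0 := by
    obtain ⟨i, a, b, h1, h2⟩ := hne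
    intro h
    refine h1 ?_
    have := congrFun (congrFun h i) (a, b)
    simpa [hY', h2] using this
  set lA : A × B → ℝ := fun k => (1 - α) / (2 * α) * Real.log (s k.1) with hlA
  set lB : A × B → ℝ := fun k => (β - 1) / (2 * β) * Real.log (T k.2) with hlB
  set lC : A × B → ℝ := fun k =>
    (1 - γ) / (2 * γ) * (Real.log (s k.1) + Real.log (T k.2)) with hlC
  have hYA : (Y * diagonal fun k => ((supPow (s k.1) ((1 - α) / (2 * α)) : ℝ) : ℂ)) =
      Y' * diagonal fun k => ((Real.exp (lA k) : ℝ) : ℂ) := by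
    ext i k
    rw [mul_diagonal, mul_diagonal, hY', Matrix.of_apply]
    split_ifs with h
    · simp [h, supPow]
    · rw [supPow_eq_exp ((hs _).lt_of_ne' h)]
  have hYC : (Y * diagonal fun k =>
      ((supPow (s k.1 * T k.2) ((1 - γ) / (2 * γ)) : ℝ) : ℂ)) =
      Y' * diagonal fun k => ((Real.exp (lC k) : ℝ) : ℂ) := by
    ext i k
    rw [mul_diagonal, mul_diagonal, hY', Matrix.of_apply]
    split_ifs with h
    · simp [h, supPow]
    · by_cases hk : t k.2 = 0
      · rw [hY0 k hk, zero_mul, zero_mul]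
      · have h1 := (hs k.1).lt_of_ne' h
        rw [supPow_eq_exp (mul_pos h1 (hTpos _ hk)), Real.log_mul h (hTpos _ hk).ne']
  rw [hYA, hYC]
  set S := schattenSum 2 (Y' * diagonal fun k => ((Real.exp (lB k) : ℝ) : ℂ)) with hS
  have hSpos : 0 < S := by
    refine schattenSum_pos two_ne_zero fun h => hY'0 (Matrix.ext fun i k => ?_)
    have := congrFun (congrFun h i) k
    rw [mul_diagonal, Matrix.zero_apply] at this
    exact (mul_eq_zero.1 this).resolve_right (Complex.ofReal_ne_zero.2 (Real.exp_pos _).ne')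
  have hSsum : S = ∑ b, (∑ a, ∑ i, ‖Y' i (a, b)‖ ^ 2) * Real.exp ((β - 1) / β * Real.log (T b)) := by
    rw [hS, schattenSum_two, Fintype.sum_prod_type_right]
    refine Finset.sum_congr rfl fun b _ => ?_
    rw [Finset.sum_mul]
    refine Finset.sum_congr rfl fun a _ => ?_
    rw [Finset.sum_mul]
    refine Finset.sum_congr rfl fun i _ => ?_
    rw [mul_diagonal, norm_mul, mul_pow, Complex.norm_real, Real.norm_of_nonneg (Real.exp_pos _).le,
      ← Real.exp_nat_mul]
    congr 2
    simp only [hlB]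
    push_cast
    field_simp
  have hZsum : ∑ b, t b * Real.exp ((β - 1) / β * Real.log (T b)) = Z ^ β⁻¹ := by
    have h1 : ∀ b, t b * Real.exp ((β - 1) / β * Real.log (T b)) =
        supPow (t b) β * Z ^ (β⁻¹ - 1) := fun b => by
      by_cases hb : t b = 0
      · simp [hb, supPow]
      · have htb := (ht0 b).lt_of_ne' hb
        simp only [hT, supPow, if_neg hb]
        rw [Real.log_div (Real.rpow_pos_of_pos htb _).ne' hZ0.ne', Real.log_rpow htb,
          Real.rpow_def_of_pos htb, Real.rpow_def_of_pos hZ0, ← Real.exp_add]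
        conv_lhs => rw [← Real.exp_log htb]
        rw [← Real.exp_add, Real.log_exp]
        congr 1
        field_simp
        ring
    rw [Finset.sum_congr rfl fun b _ => h1 b, ← Finset.sum_mul, ← hZ, Real.rpow_sub_one hZ0.ne']
    field_simp
  have hY'le : ∀ i k, ‖Y' i k‖ ≤ ‖Y i k‖ := fun i k => by
    simp only [hY', Matrix.of_apply]
    split_ifs
    · simp
    · exact le_rfl
  have hSle : Real.logb 2 S ≤ β⁻¹ * Real.logb 2 Z := by
    rw [← Real.logb_rpow_eq_mul_logb_of_pos hZ0]
    refine Real.logb_le_logb_of_le one_lt_two hSpos ?_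
    rw [hSsum, ← hZsum]
    refine Finset.sum_le_sum fun b _ => mul_le_mul_of_nonneg_right ?_ (Real.exp_pos _).le
    rw [← ht]
    exact Finset.sum_le_sum fun a _ => Finset.sum_le_sum fun i _ =>
      pow_le_pow_left₀ (norm_nonneg _) (hY'le i (a, b)) 2
  have hSeq : ¬ α < 1 → Real.logb 2 S = β⁻¹ * Real.logb 2 Z := fun h => by
    have hYY : Y' = Y := by
      ext i k
      simp only [hY', Matrix.of_apply]
      split_ifs with hk
      · exact ((hdom.resolve_right h) k.1 hk i k.2).symm
      · rfl
    rw [← Real.logb_rpow_eq_mul_logb_of_pos hZ0, hSsum, ← hZsum, hYY]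
    simp only [ht]
  refine (renyi_interpolation hα hβ hγ hα1 hβ1 hγ1 hrel hsign hY'0 (fun k => Real.log (s k.1))
    (fun k => Real.log (T k.2)) hSle hSeq).trans_eq ?_
  congr 1
  rw [← neg_sub β 1, inv_neg, div_neg]
  field_simp

theorem unitary_conj_one {n : Type*} [Fintype n] [DecidableEq n] {U : Matrix n n ℂ}
    (hU : U ∈ Matrix.unitaryGroup n ℂ) :
    U * diagonal (fun _ => ((1 : ℝ) : ℂ)) * star U = 1 := by
  rw [Complex.ofReal_one, diagonal_one, Matrix.mul_one, (Matrix.mem_unitaryGroup_iff).1 hU]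

open scoped MatrixOrder Matrix.Norms.L2Operator in
theorem Matrix.PosSemidef.exists_eq_conjTranspose_mul_self {n : Type*} [Fintype n]
    [DecidableEq n] {M : Matrix n n ℂ} (hM : M.PosSemidef) : ∃ X : Matrix n n ℂ, M = Xᴴ * X :=
  CStarAlgebra.nonneg_iff_eq_star_mul_self.1 hM.nonneg

theorem trace_margSnd {A B : Type*} [Fintype A] [Fintype B]
    (ρ : Matrix (A × B) (A × B) ℂ) : (margSnd ρ).trace = ρ.trace := by
  simp only [Matrix.trace, diag_apply, margSnd, Matrix.of_apply, Fintype.sum_prod_type]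
  exact Finset.sum_comm

section Bipartite

variable {A B : Type*} [Fintype A] [Fintype B] [DecidableEq A] [DecidableEq B]

theorem sum_norm_sq_eq_margSnd_eigenvalue {X : Matrix (A × B) (A × B) ℂ} {U : Matrix A A ℂ}
    {V : Matrix B B ℂ} (hU : U ∈ Matrix.unitaryGroup A ℂ) (hV : V ∈ Matrix.unitaryGroup B ℂ)
    {t : B → ℝ} (h : margSnd (Xᴴ * X) = V * diagonal (fun b => (t b : ℂ)) * star V) (b : B) :
    ∑ a, ∑ i, ‖(X * (U ⊗ₖ V)) i (a, b)‖ ^ 2 = t b := by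
  have h1 := trace_mul_one_kronecker (Xᴴ * X)
    (V * diagonal (fun j => (((if j = b then 1 else 0 : ℝ)) : ℂ)) * star V)
  have h2 : V * diagonal (fun b => (t b : ℂ)) * star V *
      (V * diagonal (fun j => (((if j = b then 1 else 0 : ℝ)) : ℂ)) * star V) =
      V * (diagonal (fun b => (t b : ℂ)) *
        diagonal (fun j => (((if j = b then 1 else 0 : ℝ)) : ℂ))) * star V := by
    have hV1 : star V * V = 1 := (Matrix.mem_unitaryGroup_iff').1 hV
    calc _ = V * diagonal (fun b => (t b : ℂ)) * (star V * V) *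
        diagonal (fun j => (((if j = b then 1 else 0 : ℝ)) : ℂ)) * star V := by
          simp only [Matrix.mul_assoc]
      _ = _ := by rw [hV1, Matrix.mul_one]; simp only [Matrix.mul_assoc]
  rw [← unitary_conj_one hU, unitary_conj_diagonal_kronecker,
    trace_conjTranspose_mul_self_mul_conj_diagonal, h, h2, trace_unitary_conj _ hV,
    diagonal_mul_diagonal, trace_diagonal] at h1
  have h3 := congrArg Complex.re h1
  rw [Complex.ofReal_re, Complex.re_sum, Fintype.sum_prod_type_right] at h3
  simpa [← Complex.ofReal_mul, Finset.sum_ite_eq', apply_ite, ← Finset.sum_mul] using h3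

theorem mutInfDown_le_add_renyiDiv {ρ : Matrix (A × B) (A × B) ℂ} (hρ : IsDensity ρ)
    {α β γ : ℝ} (hα : 0 < α) (hβ : 1 / 2 ≤ β) (hγ : 1 / 2 ≤ γ)
    (hα1 : α ≠ 1) (hβ1 : β ≠ 1) (hγ1 : γ ≠ 1)
    (hrel : α / (α - 1) = β / (β - 1) + γ / (γ - 1))
    (hsign : (α - 1) * (β - 1) * (γ - 1) < 0) {σ : Matrix A A ℂ} (hσ : IsDensity σ) :
    mutInfDown γ ρ ≤ (renyiEntropy β (margSnd ρ) : EReal) +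
      renyiDiv α ρ (σ ⊗ₖ (1 : Matrix B B ℂ)) := by
  by_cases hfin : (ρ * (σ ⊗ₖ (1 : Matrix B B ℂ))).trace ≠ 0 ∧
      (Dominates (σ ⊗ₖ (1 : Matrix B B ℂ)) ρ ∨ α < 1)
  swap
  · rw [renyiDiv, if_neg hfin, EReal.coe_add_top]
    exact le_top
  obtain ⟨X, rfl⟩ := hρ.1.exists_eq_conjTranspose_mul_self
  obtain ⟨U, hU, hσU⟩ := hσ.1.isHermitian.exists_unitary_diagonal
  have hs := hσ.1.eigenvalues_nonneg
  generalize hσ.1.isHermitian.eigenvalues = s at hσU hs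
  obtain ⟨V, hV, hρV⟩ := (isHermitian_margSnd hρ.1.isHermitian).exists_unitary_diagonal
  generalize (isHermitian_margSnd hρ.1.isHermitian).eigenvalues = t at hρV
  have hW : U ⊗ₖ V ∈ Matrix.unitaryGroup (A × B) ℂ := kronecker_mem_unitary hU hV
  have ht := sum_norm_sq_eq_margSnd_eigenvalue hU hV hρV
  have ht0 : ∀ b, 0 ≤ t b := fun b => by
    rw [← ht]
    positivity
  have ht1 : ∑ b, t b = 1 := by
    have h := trace_margSnd (Xᴴ * X)
    rw [hρ.2, hρV, trace_unitary_conj _ hV, trace_diagonal] at h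
    exact_mod_cast h
  have hT0 : ∀ b, 0 ≤ supPow (t b) β := fun b => supPow_nonneg (ht0 b) β
  have hTpos : ∀ b, t b ≠ 0 → 0 < supPow (t b) β := fun b hb => by
    rw [supPow_eq_exp ((ht0 b).lt_of_ne' hb)]
    exact Real.exp_pos _
  obtain ⟨Z, hZ⟩ : ∃ Z, Z = ∑ b, supPow (t b) β := ⟨_, rfl⟩
  have hZ0 : 0 < Z := by
    rw [hZ]
    obtain ⟨b, -, hb⟩ := Finset.exists_ne_zero_of_sum_ne_zero (ht1.trans_ne one_ne_zero)
    exact Finset.sum_pos' (fun b _ => hT0 b) ⟨b, Finset.mem_univ _, hTpos b hb⟩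
  have hτ : IsDensity (V * diagonal (fun b => ((supPow (t b) β / Z : ℝ) : ℂ)) * star V) := by
    refine ⟨?_, ?_⟩
    · refine PosSemidef.mul_mul_conjTranspose_same (posSemidef_diagonal_iff.2 fun b => ?_) V
      exact Complex.zero_le_real.2 (div_nonneg (hT0 b) hZ0.le)
    · rw [trace_unitary_conj _ hV, trace_diagonal]
      norm_cast
      rw [← Finset.sum_div, ← hZ, div_self hZ0.ne']
  have hσ1 : σ ⊗ₖ (1 : Matrix B B ℂ) = (U ⊗ₖ V) * diagonal (fun k => ((s k.1 : ℝ) : ℂ)) *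
      star (U ⊗ₖ V) := by
    rw [hσU, ← unitary_conj_one hV, unitary_conj_diagonal_kronecker]
    simp only [mul_one]
  have hστ := unitary_conj_diagonal_kronecker U V s fun b => supPow (t b) β / Z
  rw [← hσU] at hστ
  have hY0 : ∀ k : A × B, t k.2 = 0 → ∀ i, (X * (U ⊗ₖ V)) i k = 0 := fun k hk i => by
    rw [← ht] at hk
    have h1 := (Finset.sum_eq_zero_iff_of_nonneg
      (fun a _ => Finset.sum_nonneg fun i _ => by positivity)).1 hk k.1 (Finset.mem_univ _)
    have h2 := (Finset.sum_eq_zero_iff_of_nonneg (fun i _ => by positivity)).1 h1 i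
      (Finset.mem_univ _)
    simpa using h2
  have hne : ∃ i a b, (X * (U ⊗ₖ V)) i (a, b) ≠ 0 ∧ s a ≠ 0 := by
    by_contra! h
    refine hfin.1 ?_
    rw [hσ1, trace_conjTranspose_mul_self_mul_conj_diagonal, Complex.ofReal_eq_zero]
    refine Finset.sum_eq_zero fun k _ => ?_
    rw [Finset.sum_mul]
    refine Finset.sum_eq_zero fun i _ => ?_
    by_cases hk : (X * (U ⊗ₖ V)) i k = 0
    · simp [hk]
    · simp [h i k.1 k.2 hk]
  have hdom : (∀ a, s a = 0 → ∀ i b, (X * (U ⊗ₖ V)) i (a, b) = 0) ∨ α < 1 :=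
    hfin.2.imp_left fun h a ha i b => by
      rw [hσ1] at h
      exact h.column_eq_zero hW (k := (a, b)) ha i
  have hfin' : (Xᴴ * X * (σ ⊗ₖ (V * diagonal (fun b => ((supPow (t b) β / Z : ℝ) : ℂ)) *
      star V))).trace ≠ 0 ∧ (Dominates (σ ⊗ₖ (V * diagonal (fun b =>
        ((supPow (t b) β / Z : ℝ) : ℂ)) * star V)) (Xᴴ * X) ∨ γ < 1) := by
    rw [hστ]
    refine ⟨?_, ?_⟩
    · rw [trace_conjTranspose_mul_self_mul_conj_diagonal, Complex.ofReal_ne_zero]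
      obtain ⟨i, a, b, h1, h2⟩ := hne
      have hb : t b ≠ 0 := fun hb => h1 (hY0 (a, b) hb i)
      refine (Finset.sum_pos' (fun k _ => mul_nonneg (by positivity)
        (mul_nonneg (hs _) (div_nonneg (hT0 _) hZ0.le))) ⟨(a, b), Finset.mem_univ _, ?_⟩).ne'
      refine mul_pos (Finset.sum_pos' (fun i _ => by positivity) ⟨i, Finset.mem_univ _, ?_⟩)
        (mul_pos ((hs a).lt_of_ne' h2) (div_pos (hTpos b hb) hZ0))
      positivity
    · rcases renyi_parameter_cases hα hβ hγ hα1 hβ1 hγ1 hrel hsign with h | h | h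
      · refine Or.inl (dominates_of_column_eq_zero hW fun k hk i => ?_)
        rcases mul_eq_zero.1 hk with hk | hk
        · exact (hdom.resolve_right h.1.not_gt) k.1 hk i k.2
        · refine hY0 k ?_ i
          by_contra hb
          exact (div_pos (hTpos _ hb) hZ0).ne' hk
      · exact Or.inr h.2.2
      · exact Or.inr h.2.2.2
  refine (iInf_le _ ⟨σ, hσ⟩).trans ((iInf_le _ ⟨_, hτ⟩).trans ?_)
  have hent : (matPow (margSnd (Xᴴ * X)) β).trace.re = Z := by
    rw [hρV, matPow_unitary_conj _ hV, trace_unitary_conj _ hV, trace_diagonal, hZ, Complex.re_sum]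
    simp only [Complex.ofReal_re]
  rw [renyiDiv, renyiDiv, if_pos hfin, if_pos hfin', renyiEntropy, hent, hσ1, hστ,
    trace_sandwich_eq_schattenSum hW, trace_sandwich_eq_schattenSum hW, ← EReal.coe_add,
    EReal.coe_le_coe_iff]
  exact renyi_decomposition_diagonal hα hβ hγ hα1 hβ1 hγ1 hrel hsign _ hs ht hZ hZ0 hne hdom

end Bipartite

/-- **Decomposition rule (Theorem 1, Eq. (11)):** for `α > 0`, `β, γ ≥ 1/2` with
`α/(α−1) = β/(β−1) + γ/(γ−1)` and `(α−1)(β−1)(γ−1) < 0`, we have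
`I↓_γ(A:B)_ρ ≤ H_β(B)_ρ − H↑_α(B|A)_ρ`. -/
theorem renyi_decomposition_down_le
    {A B : Type*} [Fintype A] [Fintype B] [DecidableEq A] [DecidableEq B]
    (ρ : Matrix (A × B) (A × B) ℂ) (hρ : IsDensity ρ)
    {α β γ : ℝ} (hα : 0 < α) (hβ : 1 / 2 ≤ β) (hγ : 1 / 2 ≤ γ)
    (hα1 : α ≠ 1) (hβ1 : β ≠ 1) (hγ1 : γ ≠ 1)
    (hrel : α / (α - 1) = β / (β - 1) + γ / (γ - 1))
    (hsign : (α - 1) * (β - 1) * (γ - 1) < 0) :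
    mutInfDown γ ρ ≤ (renyiEntropy β (margSnd ρ) : EReal) - condEntUp α ρ := by
  have key : ∀ x y : EReal, ∀ h : ℝ, x ≤ h - y ↔ y ≤ h - x := fun x y h => by
    rw [EReal.le_sub_iff_add_le (.inr (EReal.coe_ne_bot h)) (.inr (EReal.coe_ne_top h)),
      EReal.le_sub_iff_add_le (.inr (EReal.coe_ne_bot h)) (.inr (EReal.coe_ne_top h)), add_comm]
  rw [key]
  refine iSup_le fun σ => ?_
  rw [← key, sub_eq_add_neg, neg_neg]
  exact mutInfDown_le_add_renyiDiv hρ hα hβ hγ hα1 hβ1 hγ1 hrel hsign σ.2
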